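/- Let F be an algebraically closed field of characteristic 0 and let V be an F-vector space of dimension N ≥ 2. Let Q be a finite abelian subgroup of PGL(V) = GL(V)/F^× such that the only elements of End_F(V) commuting with (some, hence every, lift in GL(V) of) every element of Q are the scalar multiples of the identity (equivalently, the grading induced by Q on 𝔰𝔩(V) has trivial neutral component). Then there exist integers l₁, …, l_r ≥ 2 with l₁ l₂ ⋯ l_r = N, a tensor-product decomposition V ≅ V₁ ⊗ ⋯ ⊗ V_r with dim V_i = l_i, and elements x_i, y_i ∈ SL(V_i) with x_i y_i = ξ_i y_i x_i, where ξ_i is a primitive l_i-th root of unity, such that Q is generated by the classes in PGL(V) of the operators x_i and y_i (each acting on the i-th tensor factor and as the identity on the others); in particular Q ≅ ℤ_{l₁}² × ⋯ × ℤ_{l_r}². -/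

import Mathlib

/-- The subgroup of scalar linear automorphisms of a vector space. -/
def scalarSubgroup (F V : Type*) [Field F] [AddCommGroup V] [Module F V] :
    Subgroup (V ≃ₗ[F] V) where
  carrier := {e | ∃ c : F, ∀ v : V, e v = c • v}
  one_mem' := ⟨1, fun v => (one_smul F v).symm⟩
  mul_mem' := by
    rintro f g ⟨c, hc⟩ ⟨d, hd⟩
    refine ⟨c * d, fun v => ?_⟩
    show f (g v) = (c * d) • v
    rw [hd, map_smul, hc, smul_smul, mul_comm]
  inv_mem' := by
    rintro f ⟨c, hc⟩
    by_cases hc0 : c = 0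
    · refine ⟨1, fun v => ?_⟩
      have hv : v = 0 := by
        apply f.injective
        rw [map_zero, hc, hc0, zero_smul]
      show f.symm v = 1 • v
      rw [hv, map_zero, smul_zero]
    · refine ⟨c⁻¹, fun v => ?_⟩
      show f.symm v = c⁻¹ • v
      apply f.injective
      rw [f.apply_symm_apply, map_smul, hc, smul_smul, inv_mul_cancel₀ hc0, one_smul]

instance scalarSubgroup_normal (F V : Type*) [Field F] [AddCommGroup V] [Module F V] :
    (scalarSubgroup F V).Normal := by
  constructor
  rintro f ⟨c, hc⟩ g
  refine ⟨c, fun v => ?_⟩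
  show g (f (g.symm v)) = c • v
  rw [hc, map_smul, g.apply_symm_apply]

/-- The projective general linear group `PGL(V) = GL(V)/F^×`. -/
abbrev PGL (F V : Type*) [Field F] [AddCommGroup V] [Module F V] :=
  (V ≃ₗ[F] V) ⧸ scalarSubgroup F V

/-- The automorphism of `V` obtained, via the identification `e` of `V` with a tensor
product, from an automorphism `x i` of the `i`-th tensor factor (acting as the identity
on the other factors). -/
noncomputable def inducedFactorAut (F : Type*) [Field F] {r : ℕ} {l : Fin r → ℕ}
    {V : Type*} [AddCommGroup V] [Module F V]
    (e : V ≃ₗ[F] PiTensorProduct F fun i => Fin (l i) → F)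
    (x : ∀ i, (Fin (l i) → F) ≃ₗ[F] (Fin (l i) → F)) (i : Fin r) : V ≃ₗ[F] V :=
  (e.trans (PiTensorProduct.congr
    (Function.update (fun j => LinearEquiv.refl F (Fin (l j) → F)) i (x i)))).trans e.symm


theorem symplectic_basis {F : Type} [Field F] (n : ℕ) :
    ∀ (Q : Type) [CommGroup Q] [Finite Q] (β : Q →* Q →* Fˣ)
    (_halt : ∀ a, β a a = 1) (_hnd : ∀ a, (∀ b, β a b = 1) → a = 1) (_hn : Nat.card Q = n),
    ∃ (r : ℕ) (l : Fin r → ℕ) (a b : Fin r → Q), (∀ i, 2 ≤ l i) ∧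
      (∀ i, IsPrimitiveRoot (β (a i) (b i)) (l i)) ∧
      (∀ i j, β (a i) (a j) = 1) ∧ (∀ i j, β (b i) (b j) = 1) ∧
      (∀ i j, i ≠ j → β (a i) (b j) = 1) ∧
      Subgroup.closure (Set.range a ∪ Set.range b) = ⊤ := by
  induction n using Nat.strong_induction_on with
  | _ n ih =>
  intro Q _ _ β halt hnd hn
  by_cases hQ : Subsingleton Q
  · exact ⟨0, Fin.elim0, Fin.elim0, Fin.elim0, fun i => i.elim0, fun i => i.elim0,
      fun i => i.elim0, fun i => i.elim0, fun i => i.elim0, Subsingleton.elim _ _⟩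
  have hskew : ∀ a b, β b a = (β a b)⁻¹ := by
    intro a b
    have := halt (a * b)
    simp only [map_mul, MonoidHom.mul_apply, halt, one_mul, mul_one] at this
    exact eq_inv_of_mul_eq_one_left (by rw [mul_comm]; simpa [mul_comm] using this)
  have hee : Monoid.ExponentExists Q := Monoid.ExponentExists.of_finite
  obtain ⟨a, ha⟩ := Monoid.exists_orderOf_eq_exponent hee
  set m := Monoid.exponent Q with hm
  have hm0 : m ≠ 0 := hee.exponent_ne_zero
  have hpow : ∀ x y, (β x y) ^ m = 1 := by
    intro x y
    rw [← map_pow, Monoid.pow_exponent_eq_one, map_one]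
  have hm2 : 2 ≤ m := by
    rcases Nat.lt_or_ge m 2 with h | h
    · exfalso
      apply hQ
      have : m = 1 := by omega
      exact Monoid.exp_eq_one_iff.mp this
    · exact h
  -- find b
  obtain ⟨b, hb⟩ : ∃ b, IsPrimitiveRoot (β a b) m := by
    have : Finite (β a).range := Set.finite_range (β a)
    obtain ⟨⟨g, b, hg⟩, hgen⟩ := (inferInstance : IsCyclic (β a).range).exists_generator
    refine ⟨b, ?_⟩
    have key : a ^ orderOf (β a b) = 1 := by
      apply hnd
      intro c
      obtain ⟨k, hk⟩ := hgen ⟨β a c, c, rfl⟩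
      have hk' : g ^ k = β a c := by simpa using congrArg Subtype.val hk
      rw [map_pow, MonoidHom.pow_apply, ← hk', ← hg, ← zpow_natCast, ← zpow_mul, mul_comm,
        zpow_mul, zpow_natCast, pow_orderOf_eq_one, one_zpow]
    have h1 : m ∣ orderOf (β a b) := by
      rw [← ha]; exact orderOf_dvd_of_pow_eq_one key
    have h2 : orderOf (β a b) ∣ m := orderOf_dvd_of_pow_eq_one (hpow a b)
    rw [← Nat.dvd_antisymm h2 h1]
    exact IsPrimitiveRoot.orderOf _
  have hexp : ∀ x y, ∃ s : ℤ, (β a b) ^ s = β x y := by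
    intro x y
    have : NeZero m := ⟨hm0⟩
    have : β x y ∈ Subgroup.zpowers (β a b) := by
      rw [hb.zpowers_eq]; exact hpow x y
    exact this
  let S : Subgroup Q := (β a).ker ⊓ (β b).ker
  have hS : ∀ c, c ∈ S ↔ β a c = 1 ∧ β b c = 1 := fun c => Iff.rfl
  have hdec : ∀ c : Q, ∃ s t : ℤ, ∃ d ∈ S, c = d * b ^ s * a ^ t := by
    intro c
    obtain ⟨s, hs⟩ := hexp a c
    obtain ⟨t, ht⟩ := hexp b c
    refine ⟨s, -t, c * (a ^ t) * (b ^ (-s)), ?_, ?_⟩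
    · rw [hS]
      simp only [map_mul, map_zpow, halt, ← hs, ← ht, hskew a b]
      simp
    · simp [mul_assoc]
  have hSne : Nat.card S < n := by
    rw [← hn]
    apply lt_of_le_of_ne (Subgroup.card_le_card_group S)
    intro h
    have : S = ⊤ := Subgroup.eq_top_of_card_eq S h
    have h3 : b ∈ S := this ▸ Subgroup.mem_top b
    have h4 := ((hS b).1 h3).1
    rw [h4] at hb
    have := hb.eq_orderOf
    simp at this
    omega
  obtain ⟨r, l, a', b', h2, hp, haa, hbb, hab, hcl⟩ := ih _ hSne S
    ((β.comp S.subtype).compl₂ S.subtype) (fun x => by simp [halt])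
    (by
      intro x hx
      apply Subtype.ext
      apply hnd
      intro c
      obtain ⟨s, t, d, hd, rfl⟩ := hdec c
      have h1 := (hS _).1 x.2
      have h5 := hx ⟨d, hd⟩
      simp at h5
      simp [h5, hskew a x.1, hskew b x.1, h1.1, h1.2]) rfl
  simp only [MonoidHom.compl₂_apply, MonoidHom.comp_apply, Subgroup.coe_subtype] at hp haa hbb hab
  have hA : ∀ x : S, β a x = 1 := fun x => ((hS _).1 x.2).1
  have hB : ∀ x : S, β b x = 1 := fun x => ((hS _).1 x.2).2
  have hA' : ∀ x : S, β x a = 1 := fun x => by rw [hskew a, hA, inv_one]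
  have hB' : ∀ x : S, β x b = 1 := fun x => by rw [hskew b, hB, inv_one]
  refine ⟨r + 1, Fin.cons m l, Fin.cons a (fun i => (a' i : Q)), Fin.cons b (fun i => (b' i : Q)),
    ?_, ?_, ?_, ?_, ?_, ?_⟩
  · intro i; refine Fin.cases ?_ (fun i => ?_) i <;> simp [hm2, h2]
  · intro i; refine Fin.cases ?_ (fun i => ?_) i <;> simp [hb, hp]
  · intro i j
    refine Fin.cases ?_ (fun i => ?_) i <;> refine Fin.cases ?_ (fun j => ?_) j <;>
      simp [halt, haa, hA, hA']
  · intro i j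
    refine Fin.cases ?_ (fun i => ?_) i <;> refine Fin.cases ?_ (fun j => ?_) j <;>
      simp [halt, hbb, hB, hB']
  · intro i j
    refine Fin.cases ?_ (fun i => ?_) i <;> refine Fin.cases ?_ (fun j => ?_) j <;>
      simp [hA, hB'] 
    exact hab i j
  · rw [eq_top_iff]
    rintro c -
    obtain ⟨s, t, d, hd, rfl⟩ := hdec c
    set K := Subgroup.closure (Set.range (Fin.cons a (fun i => (a' i : Q)) : Fin (r+1) → Q) ∪
      Set.range (Fin.cons b (fun i => (b' i : Q)) : Fin (r+1) → Q)) with hK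
    have ha0 : a ∈ K := Subgroup.subset_closure (Or.inl ⟨0, rfl⟩)
    have hb0 : b ∈ K := Subgroup.subset_closure (Or.inr ⟨0, rfl⟩)
    have hdK : d ∈ K := by
      have h6 : Subgroup.closure (Set.range a' ∪ Set.range b') ≤ K.comap S.subtype := by
        rw [Subgroup.closure_le]
        rintro x (⟨i, rfl⟩ | ⟨i, rfl⟩)
        · exact Subgroup.subset_closure (Or.inl ⟨i.succ, rfl⟩)
        · exact Subgroup.subset_closure (Or.inr ⟨i.succ, rfl⟩)
      rw [hcl] at h6
      exact h6 (Subgroup.mem_top (⟨d, hd⟩ : S))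
    exact K.mul_mem (K.mul_mem hdK (K.zpow_mem hb0 s)) (K.zpow_mem ha0 t)

/-- hom from ZMod n sending 1 to g -/
noncomputable def zh {G : Type*} [Group G] {n : ℕ} (g : G) (h : g ^ n = 1) :
    Multiplicative (ZMod n) →* G :=
  AddMonoidHom.toMultiplicativeLeft (ZMod.lift n ⟨(zmultiplesHom (Additive G)) (Additive.ofMul g), by
    simpa using congrArg Additive.ofMul h⟩)

theorem zh_int {G : Type*} [Group G] {n : ℕ} (g : G) (h : g ^ n = 1) (k : ℤ) :
    zh g h (Multiplicative.ofAdd (k : ZMod n)) = g ^ k := by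
  simp [zh]

theorem zh_one {G : Type*} [Group G] {n : ℕ} (g : G) (h : g ^ n = 1) :
    zh g h (Multiplicative.ofAdd 1) = g := by
  simpa using zh_int g h 1

theorem zh_inj {G : Type*} [CommGroup G] {n : ℕ} (g : G) (h : g ^ n = 1) (hp : IsPrimitiveRoot g n) :
    Function.Injective (zh g h) := by
  rw [injective_iff_map_eq_one]
  intro x
  obtain ⟨k, hk⟩ := ZMod.intCast_surjective x.toAdd
  have : x = Multiplicative.ofAdd (k : ZMod n) := by rw [hk]; rfl
  rw [this, zh_int, hp.zpow_eq_one_iff_dvd, ← ZMod.intCast_zmod_eq_zero_iff_dvd]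
  rintro h; rw [h]; rfl

theorem zmod_hom_ext {G : Type*} [Group G] {n : ℕ} {f g : Multiplicative (ZMod n) →* G}
    (h : f (Multiplicative.ofAdd 1) = g (Multiplicative.ofAdd 1)) : f = g := by
  refine MonoidHom.ext fun x => ?_
  obtain ⟨k, hk⟩ := ZMod.intCast_surjective x.toAdd
  have : x = (Multiplicative.ofAdd (1 : ZMod n)) ^ k := by
    apply Multiplicative.toAdd.injective
    simp [← hk]
  rw [this, map_zpow, map_zpow, h]

/-- The product of the cyclic groups. -/
abbrev PP {r : ℕ} (l : Fin r → ℕ) := (i : Fin r) → Multiplicative (ZMod (l i))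

theorem PP_hom_ext {r : ℕ} {l : Fin r → ℕ} {G : Type*} [Group G] {f g : PP l →* G}
    (h : ∀ i, f (Pi.mulSingle i (Multiplicative.ofAdd 1)) =
      g (Pi.mulSingle i (Multiplicative.ofAdd 1))) : f = g := by
  refine MonoidHom.pi_ext fun i x => ?_
  have : f.comp (MonoidHom.mulSingle (fun i => Multiplicative (ZMod (l i))) i) =
      g.comp (MonoidHom.mulSingle (fun i => Multiplicative (ZMod (l i))) i) :=
    zmod_hom_ext (h i)
  exact DFunLike.congr_fun this x

theorem PP_hom_exists {r : ℕ} {l : Fin r → ℕ} {G : Type*} [Group G] (Y : Fin r → G)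
    (hY : ∀ i, Y i ^ l i = 1) (hc : ∀ i j, Commute (Y i) (Y j)) :
    ∃ Φ : PP l →* G, ∀ i, Φ (Pi.mulSingle i (Multiplicative.ofAdd 1)) = Y i := by
  have hcm : Pairwise fun i j => ∀ (x : Multiplicative (ZMod (l i)))
      (y : Multiplicative (ZMod (l j))), Commute (zh (Y i) (hY i) x) (zh (Y j) (hY j) y) := by
    intro i j _ x y
    obtain ⟨k, hk⟩ := ZMod.intCast_surjective x.toAdd
    have hx : x = Multiplicative.ofAdd (k : ZMod (l i)) := by rw [hk]; rfl
    obtain ⟨m, hm⟩ := ZMod.intCast_surjective y.toAdd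
    have hy : y = Multiplicative.ofAdd (m : ZMod (l j)) := by rw [hm]; rfl
    rw [hx, hy, zh_int, zh_int]
    exact (hc i j).zpow_zpow k m
  refine ⟨MonoidHom.noncommPiCoprod (fun i => zh (Y i) (hY i)) hcm, fun i => ?_⟩
  rw [MonoidHom.noncommPiCoprod_mulSingle, zh_one]

theorem pairing_PP {r : ℕ} {l : Fin r → ℕ} {G H : Type*} [Group G] [CommGroup H] (Y : Fin r → G)
    (Φ : PP l →* G) (hΦ : ∀ i, Φ (Pi.mulSingle i (Multiplicative.ofAdd 1)) = Y i)
    (χ : G →* H) (j : Fin r) (hj : χ (Y j) ^ l j = 1) (hχ : ∀ i, i ≠ j → χ (Y i) = 1) (k : PP l) :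
    χ (Φ k) = zh (χ (Y j)) hj (k j) := by
  have : χ.comp Φ = (zh (χ (Y j)) hj).comp (Pi.evalMonoidHom _ j) := by
    apply PP_hom_ext
    intro i
    simp only [MonoidHom.comp_apply, hΦ, Pi.evalMonoidHom_apply]
    by_cases h : i = j
    · subst h
      rw [Pi.mulSingle_eq_same, zh_one]
    · rw [Pi.mulSingle_eq_of_ne (Ne.symm h), map_one, hχ i h]
  exact DFunLike.congr_fun this k

theorem symplectic_iso {F : Type} [Field F] 
    (Q : Type) [CommGroup Q] (β : Q →* Q →* Fˣ)
    (hskew : ∀ a b, β b a = (β a b)⁻¹)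
    (r : ℕ) (l : Fin r → ℕ) (a b : Fin r → Q)
    (hla : ∀ i, a i ^ l i = 1) (hlb : ∀ i, b i ^ l i = 1)
    (hp : ∀ i, IsPrimitiveRoot (β (a i) (b i)) (l i))
    (haa : ∀ i j, β (a i) (a j) = 1) (hbb : ∀ i j, β (b i) (b j) = 1)
    (hab : ∀ i j, i ≠ j → β (a i) (b j) = 1)
    (hcl : Subgroup.closure (Set.range a ∪ Set.range b) = ⊤) :
    Nonempty (Q ≃* ((i : Fin r) → Multiplicative (ZMod (l i) × ZMod (l i)))) := by
  obtain ⟨A, hA⟩ := PP_hom_exists a hla (fun i j => Commute.all _ _)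
  obtain ⟨B, hB⟩ := PP_hom_exists b hlb (fun i j => Commute.all _ _)
  have h1 : ∀ j, β (a j) (b j) ^ l j = 1 := fun j => (hp j).pow_eq_one
  have h2 : ∀ j, β (b j) (a j) ^ l j = 1 := fun j => by rw [hskew (a j), inv_pow, h1, inv_one]
  have h3 : ∀ j k, β (a j) (B k) = zh _ (h1 j) (k j) := fun j k =>
    pairing_PP b B hB (β (a j)) j (h1 j) (fun i hi => hab j i (Ne.symm hi)) k
  have h4 : ∀ j k, β (b j) (A k) = zh _ (h2 j) (k j) := fun j k =>
    pairing_PP a A hA (β (b j)) j (h2 j) (fun i hi => by rw [hskew (a i), hab i j hi, inv_one]) k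
  have h5 : ∀ j k, β (a j) (A k) = 1 := fun j k => by
    have : (β (a j)).comp A = 1 := PP_hom_ext (fun i => by simp [hA, haa])
    exact DFunLike.congr_fun this k
  have h6 : ∀ j k, β (b j) (B k) = 1 := fun j k => by
    have : (β (b j)).comp B = 1 := PP_hom_ext (fun i => by simp [hB, hbb])
    exact DFunLike.congr_fun this k
  let Ψ : PP l × PP l →* Q := A.coprod B
  have hinj : Function.Injective Ψ := by
    rw [injective_iff_map_eq_one]
    rintro ⟨k, m⟩ h
    have h : A k * B m = 1 := h
    have e1 : k = 1 := by
      funext j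
      have := congrArg (β (b j)) h
      rw [map_mul, h4, h6, mul_one, map_one] at this
      exact (injective_iff_map_eq_one _).1
        (zh_inj _ (h2 j) (by rw [hskew (a j)]; exact (hp j).inv)) _ this
    have e2 : m = 1 := by
      funext j
      have := congrArg (β (a j)) h
      rw [map_mul, h3, h5, one_mul, map_one] at this
      exact (injective_iff_map_eq_one _).1 (zh_inj _ (h1 j) (hp j)) _ this
    rw [e1, e2]; rfl
  have hsurj : Function.Surjective Ψ := by
    rw [← MonoidHom.range_eq_top, eq_top_iff, ← hcl, Subgroup.closure_le]
    rintro x (⟨i, rfl⟩ | ⟨i, rfl⟩)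
    · exact ⟨(Pi.mulSingle i (Multiplicative.ofAdd 1), 1), by simp [Ψ, hA]⟩
    · exact ⟨(1, Pi.mulSingle i (Multiplicative.ofAdd 1)), by simp [Ψ, hB]⟩
  let E : PP l × PP l ≃* ((i : Fin r) → Multiplicative (ZMod (l i) × ZMod (l i))) :=
    { toFun := fun k i => Multiplicative.ofAdd ((k.1 i).toAdd, (k.2 i).toAdd)
      invFun := fun k => (fun i => Multiplicative.ofAdd (k i).toAdd.1,
        fun i => Multiplicative.ofAdd (k i).toAdd.2)
      left_inv := fun k => rfl
      right_inv := fun k => rfl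
      map_mul' := fun k m => rfl }
  exact ⟨(MulEquiv.ofBijective Ψ ⟨hinj, hsurj⟩).symm.trans E⟩

theorem induced_apply {F : Type*} [Field F] {r : ℕ} {l : Fin r → ℕ}
    {V : Type*} [AddCommGroup V] [Module F V]
    (κ : Fin r → Type*) (bz : ∀ i, Module.Basis (κ i) F (Fin (l i) → F))
    (b : Module.Basis (∀ i, κ i) F V)
    (x : ∀ i, (Fin (l i) → F) ≃ₗ[F] (Fin (l i) → F)) (i : Fin r) (k : ∀ i, κ i) (d : F) (t : κ i)
    (h : x i (bz i (k i)) = d • bz i t) :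
    inducedFactorAut F (b.equiv (Basis.piTensorProduct bz) (Equiv.refl _)) x i (b k) =
      d • b (Function.update k i t) := by
  unfold inducedFactorAut
  simp only [LinearEquiv.trans_apply, Module.Basis.equiv_apply, Equiv.refl_apply,
    Basis.piTensorProduct_apply, PiTensorProduct.congr_tprod]
  rw [LinearEquiv.symm_apply_eq, map_smul, Module.Basis.equiv_apply, Equiv.refl_apply,
    Basis.piTensorProduct_apply]
  have e1 : (fun j => (Function.update (fun j => LinearEquiv.refl F (Fin (l j) → F)) i (x i) j)
      ((bz j) (k j))) = Function.update (fun j => bz j (k j)) i (d • bz i t) := by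
    funext j
    by_cases hj : j = i
    · subst hj; simp [h]
    · simp [hj]
  have e2 : (fun j => bz j (Function.update k i t j)) =
      Function.update (fun j => bz j (k j)) i (bz i t) := by
    funext j
    by_cases hj : j = i
    · subst hj; simp
    · simp [hj]
  rw [e1, e2, MultilinearMap.map_update_smul]

theorem exists_unit_pow {F : Type*} [Field F] [IsAlgClosed F] (n : ℕ) (hn : n ≠ 0) (c : Fˣ) :
    ∃ d : Fˣ, d ^ n = c := by
  obtain ⟨z, hz⟩ := IsAlgClosed.exists_pow_nat_eq (c : F) (Nat.pos_of_ne_zero hn)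
  have hz0 : z ≠ 0 := by
    rintro rfl
    rw [zero_pow hn] at hz
    exact c.ne_zero hz.symm
  exact ⟨Units.mk0 z hz0, Units.ext (by simpa using hz)⟩

theorem exists_det_scale {F : Type*} [Field F] [IsAlgClosed F] (n : ℕ) (hn : n ≠ 0)
    (x : (Fin n → F) ≃ₗ[F] (Fin n → F)) :
    ∃ s : Fˣ, LinearMap.det ((s : F) • x.toLinearMap) = 1 := by
  obtain ⟨s, hs⟩ := exists_unit_pow n hn (LinearEquiv.det x)⁻¹
  refine ⟨s, ?_⟩
  rw [LinearMap.det_smul, Module.finrank_fin_fun, ← Units.val_pow_eq_pow_val, hs]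
  rw [← LinearEquiv.coe_det, ← Units.val_mul, inv_mul_cancel, Units.val_one]

theorem tensor_part (F V : Type) [Field F] [IsAlgClosed F]
    [AddCommGroup V] [Module F V] {r : ℕ} (l : Fin r → ℕ) (hl : ∀ i, 2 ≤ l i)
    (b : Module.Basis (PP l) F V) (X Y : Fin r → V ≃ₗ[F] V)
    (c : ∀ i, Multiplicative (ZMod (l i)) → Fˣ) (ξ : Fin r → F)
    (hc : ∀ i t, (c i (Multiplicative.ofAdd 1 * t) : F) = ξ i * c i t)
    (hX : ∀ i k, X i (b k) = (c i (k i) : F) • b k)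
    (hY : ∀ i k, Y i (b k) = b (Pi.mulSingle i (Multiplicative.ofAdd 1) * k)) :
    ∃ (e : V ≃ₗ[F] PiTensorProduct F fun i => Fin (l i) → F)
        (x y : ∀ i, (Fin (l i) → F) ≃ₗ[F] (Fin (l i) → F)),
        (∀ i, LinearMap.det (x i).toLinearMap = 1) ∧
        (∀ i, LinearMap.det (y i).toLinearMap = 1) ∧
        (∀ i, (x i).toLinearMap ∘ₗ (y i).toLinearMap =
          ξ i • ((y i).toLinearMap ∘ₗ (x i).toLinearMap)) ∧
        (∀ i, (QuotientGroup.mk (inducedFactorAut F e x i) : PGL F V) = QuotientGroup.mk (X i)) ∧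
        (∀ i, (QuotientGroup.mk (inducedFactorAut F e y i) : PGL F V) = QuotientGroup.mk (Y i)) := by
  have hl0 : ∀ i, NeZero (l i) := fun i => ⟨by have := hl i; omega⟩
  let bz : ∀ i, Module.Basis (Multiplicative (ZMod (l i))) F (Fin (l i) → F) := fun i =>
    (Pi.basisFun F (Fin (l i))).reindex ((ZMod.finEquiv (l i)).toEquiv.trans Multiplicative.ofAdd)
  let x0 : ∀ i, (Fin (l i) → F) ≃ₗ[F] (Fin (l i) → F) := fun i =>
    (bz i).equiv ((bz i).unitsSMul (c i)) (Equiv.refl _)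
  let y0 : ∀ i, (Fin (l i) → F) ≃ₗ[F] (Fin (l i) → F) := fun i =>
    (bz i).equiv (bz i) (Equiv.mulLeft (Multiplicative.ofAdd 1))
  choose s hs using fun i => exists_det_scale (l i) (hl0 i).ne (x0 i)
  choose u hu using fun i => exists_det_scale (l i) (hl0 i).ne (y0 i)
  let x : ∀ i, (Fin (l i) → F) ≃ₗ[F] (Fin (l i) → F) := fun i =>
    (x0 i).trans (LinearEquiv.smulOfUnit (s i))
  let y : ∀ i, (Fin (l i) → F) ≃ₗ[F] (Fin (l i) → F) := fun i =>
    (y0 i).trans (LinearEquiv.smulOfUnit (u i))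
  have hx : ∀ i t, x i (bz i t) = ((s i : F) * c i t) • bz i t := by
    intro i t
    change (s i : F) • ((bz i).equiv ((bz i).unitsSMul (c i)) (Equiv.refl _)) (bz i t) = _
    rw [Module.Basis.equiv_apply, Module.Basis.unitsSMul_apply, mul_smul]
    rfl
  have hy : ∀ i t, y i (bz i t) = (u i : F) • bz i (Multiplicative.ofAdd 1 * t) := by
    intro i t
    change (u i : F) • ((bz i).equiv (bz i) (Equiv.mulLeft (Multiplicative.ofAdd 1))) (bz i t) = _
    rw [Module.Basis.equiv_apply]
    rfl
  have hmk : ∀ (g h : V ≃ₗ[F] V) (d : F), d ≠ 0 → (∀ k, g (b k) = d • h (b k)) →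
      (QuotientGroup.mk g : PGL F V) = QuotientGroup.mk h := by
    intro g h d hd hh
    symm
    rw [QuotientGroup.eq]
    refine ⟨d, fun v => ?_⟩
    change h.symm (g v) = d • v
    rw [LinearEquiv.symm_apply_eq, map_smul]
    have : g.toLinearMap = d • h.toLinearMap := b.ext hh
    exact DFunLike.congr_fun this v
  refine ⟨b.equiv (Basis.piTensorProduct bz) (Equiv.refl _), x, y, fun i => ?_, fun i => ?_,
    fun i => ?_, fun i => ?_, fun i => ?_⟩
  · rw [← hs i]; rfl
  · rw [← hu i]; rfl
  · apply (bz i).ext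
    intro t
    simp only [LinearMap.comp_apply, LinearEquiv.coe_coe, LinearMap.smul_apply, hx, hy, map_smul,
      smul_smul, hc]
    congr 1
    ring
  · apply hmk _ _ (s i) (s i).ne_zero
    intro k
    rw [induced_apply _ bz b x i k _ _ (hx i (k i)), hX, smul_smul, Function.update_eq_self]
  · apply hmk _ _ (u i) (u i).ne_zero
    intro k
    rw [induced_apply _ bz b y i k _ _ (hy i (k i)), hY]
    congr 2
    funext j
    by_cases hj : j = i
    · subst hj; simp
    · simp [hj]

theorem exists_pairing {G H Z K : Type*} [Group G] [Group H] [CommGroup Z] [CommGroup K]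
    (sc : Z →* G) (hinj : Function.Injective sc) (hcen : ∀ c g, sc c * g = g * sc c)
    (π : G →* H) (hπ : Function.Surjective π) (hker : ∀ g, π g = 1 ↔ ∃ c, g = sc c)
    (ι : K →* H) :
    ∃ β : K →* K →* Z, ∀ p q g h, π g = ι p → π h = ι q → g * h = sc (β p q) * (h * g) := by
  have hrel : ∀ g g', π g = π g' → ∃ c, g = sc c * g' := by
    intro g g' h
    obtain ⟨c, hc⟩ := (hker (g * g'⁻¹)).1 (by rw [map_mul, map_inv, h, mul_inv_cancel])
    exact ⟨c, by rw [← hc]; group⟩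
  have hex : ∀ p q : K, ∃ c : Z, ∀ g h, π g = ι p → π h = ι q → g * h = sc c * (h * g) := by
    intro p q
    obtain ⟨g0, hg0⟩ := hπ (ι p)
    obtain ⟨h0, hh0⟩ := hπ (ι q)
    obtain ⟨c, hc⟩ := hrel (g0 * h0) (h0 * g0) (by
      rw [map_mul, map_mul, hg0, hh0, ← map_mul, ← map_mul, mul_comm])
    refine ⟨c, fun g h hg hh => ?_⟩
    obtain ⟨d, rfl⟩ := hrel g g0 (hg.trans hg0.symm)
    obtain ⟨f, rfl⟩ := hrel h h0 (hh.trans hh0.symm)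
    calc sc d * g0 * (sc f * h0) = sc d * (sc f * (g0 * h0)) := by
          rw [mul_assoc, ← mul_assoc g0, ← hcen f g0, mul_assoc]
      _ = sc d * (sc f * (sc c * (h0 * g0))) := by rw [hc]
      _ = sc c * (sc f * (sc d * (h0 * g0))) := by
          simp only [← mul_assoc, ← map_mul]
          congr 3
          rw [mul_comm (d * f), mul_comm d f, mul_assoc]
      _ = sc c * (sc f * h0 * (sc d * g0)) := by
          rw [mul_assoc (sc f), ← mul_assoc h0, ← hcen d h0, mul_assoc (sc d)]
  choose β hβ using hex
  choose T hT using fun p : K => hπ (ι p)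
  have huniq : ∀ p q c, (∃ g h, π g = ι p ∧ π h = ι q ∧ g * h = sc c * (h * g)) → β p q = c := by
    rintro p q c ⟨g, h, hg, hh, e⟩
    apply hinj
    have := hβ p q g h hg hh
    rw [e] at this
    exact (mul_right_cancel this).symm
  have hm2 : ∀ p q q', β p (q * q') = β p q * β p q' := by
    intro p q q'
    apply huniq
    refine ⟨T p, T q * T q', hT p, by rw [map_mul, map_mul, hT, hT], ?_⟩
    rw [← mul_assoc, hβ p q _ _ (hT p) (hT q), mul_assoc, mul_assoc, hβ p q' _ _ (hT p) (hT q'),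
      ← mul_assoc (T q), ← hcen, map_mul]
    simp only [mul_assoc]
  have hm1 : ∀ p p' q, β (p * p') q = β p q * β p' q := by
    intro p p' q
    apply huniq
    refine ⟨T p * T p', T q, by rw [map_mul, map_mul, hT, hT], hT q, ?_⟩
    rw [mul_assoc, hβ p' q _ _ (hT p') (hT q), ← mul_assoc (T p), ← hcen, mul_assoc,
      ← mul_assoc (T p), hβ p q _ _ (hT p) (hT q), mul_comm (β p q), map_mul]
    simp only [mul_assoc]
  refine ⟨MonoidHom.mk' (fun p => MonoidHom.mk' (β p) (hm2 p)) ?_, hβ⟩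
  intro p p'
  ext q
  exact hm1 p p' q

theorem maschke_part (F V : Type) [Field F] [CharZero F]
    [AddCommGroup V] [Module F V]
    (Q : Subgroup (PGL F V)) (hfin : Finite Q)
    (hcentral : ∀ z : Module.End F V,
      (∀ e : V ≃ₗ[F] V, (QuotientGroup.mk e : PGL F V) ∈ Q →
        z ∘ₗ (e : V ≃ₗ[F] V).toLinearMap = (e : V ≃ₗ[F] V).toLinearMap ∘ₗ z) →
      ∃ c : F, z = c • LinearMap.id)
    (W : Submodule F V) (hW : W ≠ ⊥)
    (hinv : ∀ g : V ≃ₗ[F] V, (QuotientGroup.mk g : PGL F V) ∈ Q → ∀ w ∈ W, g w ∈ W) : W = ⊤ := by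
  have : Fintype Q := Fintype.ofFinite Q
  obtain ⟨p, hp⟩ := W.subtype.exists_leftInverse_of_injective W.ker_subtype
  have hpW : ∀ w (hw : w ∈ W), (p w : V) = w := by
    intro w hw
    exact congrArg Subtype.val (DFunLike.congr_fun hp (⟨w, hw⟩ : W))
  -- conjugate of the projection
  let C : (V ≃ₗ[F] V) → Module.End F V := fun g =>
    g.toLinearMap ∘ₗ (W.subtype ∘ₗ p) ∘ₗ (g⁻¹).toLinearMap
  have hC : ∀ g v, C g v = g (p (g⁻¹ v) : V) := fun g v => rfl
  have hCs : ∀ g h : V ≃ₗ[F] V, (QuotientGroup.mk g : PGL F V) = QuotientGroup.mk h → C g = C h := by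
    intro g h hgh
    obtain ⟨c, hc⟩ := QuotientGroup.eq.1 hgh
    have e1 : ∀ v, h v = c • g v := by
      intro v
      have := congrArg g (hc v)
      rw [map_smul] at this
      rw [← this]
      change h v = g (g.symm (h v))
      simp
    ext v
    rw [hC, hC, e1, ← map_smul, ← Submodule.coe_smul, ← map_smul]
    congr 3
    change g.symm v = c • h.symm v
    rw [LinearEquiv.symm_apply_eq, map_smul, ← e1, h.apply_symm_apply]
  choose T hT using fun q : Q => QuotientGroup.mk_surjective (q : PGL F V)
  let z : Module.End F V := ∑ q : Q, C (T q)
  obtain ⟨c, hc⟩ := hcentral z (by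
    intro e he
    ext v
    simp only [z, LinearMap.comp_apply, LinearMap.sum_apply, LinearEquiv.coe_coe, map_sum]
    rw [← Equiv.sum_comp (Equiv.mulLeft (⟨_, he⟩ : Q))]
    refine Finset.sum_congr rfl fun q _ => ?_
    rw [hCs (T (Equiv.mulLeft (⟨_, he⟩ : Q) q)) (e * T q) (by
      rw [hT, QuotientGroup.mk_mul, hT]; rfl), hC, hC, mul_inv_rev]
    change e (T q (p ((T q)⁻¹ (e.symm (e v))))) = _
    rw [e.symm_apply_apply])
  have hzW : ∀ w ∈ W, z w = (Fintype.card Q : F) • w := by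
    intro w hw
    simp only [z, LinearMap.sum_apply]
    rw [Finset.sum_congr rfl (g := fun _ => w), Finset.sum_const, Finset.card_univ,
      Nat.cast_smul_eq_nsmul]
    intro q _
    rw [hC, hpW _ (hinv _ (by rw [QuotientGroup.mk_inv, hT]; exact Q.inv_mem q.2) w hw)]
    change T q ((T q).symm w) = w
    simp
  have hcard : (Fintype.card Q : F) ≠ 0 := by
    exact_mod_cast Fintype.card_ne_zero
  obtain ⟨w, hw, hw0⟩ := W.ne_bot_iff.1 hW
  have hcc : c = Fintype.card Q := by
    have := hzW w hw
    rw [hc] at this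
    exact smul_left_injective F hw0 this
  rw [eq_top_iff]
  rintro v -
  have h1 : z v ∈ W := by
    simp only [z, LinearMap.sum_apply]
    refine Submodule.sum_mem _ fun q _ => ?_
    rw [hC]
    exact hinv _ (by rw [hT]; exact q.2) _ (p _).2
  rw [hc] at h1
  exact (W.smul_mem_iff (hcc ▸ hcard : c ≠ 0)).1 h1

theorem joint_eigenvector (F V : Type) [Field F] [IsAlgClosed F]
    [AddCommGroup V] [Module F V] [FiniteDimensional F V] [Nontrivial V] {r : ℕ}
    (X : Fin r → Module.End F V) (hXX : ∀ i j, Commute (X i) (X j))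
    (hss : ∀ i, (X i).IsSemisimple) :
    ∃ (v : V) (lam : Fin r → F), v ≠ 0 ∧ ∀ i, X i v = lam i • v := by
  have h := Module.End.iSup_iInf_maxGenEigenspace_eq_top_of_iSup_maxGenEigenspace_eq_top_of_commute
    X (fun i j _ => hXX i j) (fun i => Module.End.iSup_maxGenEigenspace_eq_top (X i))
  obtain ⟨lam, hlam⟩ : ∃ χ : Fin r → F, ⨅ i, (X i).maxGenEigenspace (χ i) ≠ ⊥ := by
    by_contra! hh
    simp [hh] at h
  obtain ⟨v, hv, hv0⟩ := Submodule.ne_bot_iff _ |>.1 hlam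
  refine ⟨v, lam, hv0, fun i => ?_⟩
  have := (Submodule.mem_iInf _).1 hv i
  rw [(hss i).isFinitelySemisimple.maxGenEigenspace_eq_eigenspace] at this
  exact Module.End.mem_eigenspace_iff.1 this

theorem semisimple_of_pow (F V : Type) [Field F] [CharZero F]
    [AddCommGroup V] [Module F V] (X : Module.End F V) (n : ℕ) (hn : n ≠ 0) (h : X ^ n = 1) :
    X.IsSemisimple := by
  apply Module.End.isSemisimple_of_squarefree_aeval_eq_zero (p := Polynomial.X ^ n - 1)
  · exact (Polynomial.X_pow_sub_one_separable_iff.2 (by exact_mod_cast hn)).squarefree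
  · simp [h]

theorem basis_part (F V : Type) [Field F] [IsAlgClosed F] [CharZero F]
    [AddCommGroup V] [Module F V] [FiniteDimensional F V] [Nontrivial V] {r : ℕ} (l : Fin r → ℕ)
    (hl : ∀ i, 2 ≤ l i) (X Y : Fin r → V ≃ₗ[F] V) (ξ : Fin r → Fˣ)
    (hξ : ∀ i, IsPrimitiveRoot (ξ i) (l i))
    (hXl : ∀ i, X i ^ l i = 1) (hYl : ∀ i, Y i ^ l i = 1)
    (hXX : ∀ i j, Commute (X i) (X j)) (hYY : ∀ i j, Commute (Y i) (Y j))
    (hXY : ∀ i j, i ≠ j → Commute (X i) (Y j))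
    (hXYi : ∀ i, X i * Y i = DistribMulAction.toModuleAut F V (ξ i) * (Y i * X i))
    (hirr : ∀ W : Submodule F V, W ≠ ⊥ → (∀ i, ∀ w ∈ W, X i w ∈ W) → (∀ i, ∀ w ∈ W, Y i w ∈ W) →
      W = ⊤) :
    ∃ (b : Module.Basis (PP l) F V) (lam : Fin r → Fˣ),
      (∀ i k, X i (b k) = ((lam i * zh (ξ i) (hξ i).pow_eq_one (k i) : Fˣ) : F) • b k) ∧
      (∀ i k, Y i (b k) = b (Pi.mulSingle i (Multiplicative.ofAdd 1) * k)) := by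
  obtain ⟨Φ, hΦ⟩ := PP_hom_exists Y hYl hYY
  obtain ⟨v, lam, hv0, hv⟩ := joint_eigenvector F V (fun i => (X i).toLinearMap)
    (fun i j => by
      have := congrArg (fun g : V ≃ₗ[F] V => g.toLinearMap) (hXX i j)
      exact this)
    (fun i => semisimple_of_pow F V _ (l i) (by have := hl i; omega) (by
      have := congrArg (LinearEquiv.automorphismGroup.toLinearMapMonoidHom) (hXl i)
      rw [map_pow, map_one] at this
      exact this))
  have hlam0 : ∀ i, lam i ≠ 0 := by
    intro i h
    have := hv i
    rw [h, zero_smul] at this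
    exact hv0 ((X i).map_eq_zero_iff.1 this)
  let sc : Fˣ →* (V ≃ₗ[F] V) := DistribMulAction.toModuleAut F V
  have hcen : ∀ c g, sc c * g = g * sc c := by
    intro c g
    ext v
    change (c : F) • g v = g ((c : F) • v)
    rw [map_smul]
  have hconj : ∀ j k, X j * Φ k = sc (zh (ξ j) (hξ j).pow_eq_one (k j)) * (Φ k * X j) := by
    intro j k
    let R : PP l →* (V ≃ₗ[F] V) := MonoidHom.mk'
      (fun k => sc (zh (ξ j) (hξ j).pow_eq_one (k j)) * Φ k) (by
        intro k m
        rw [Pi.mul_apply, map_mul, map_mul, map_mul, mul_assoc, mul_assoc, ← mul_assoc (Φ k),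
          ← hcen _ (Φ k), mul_assoc])
    have : (MulAut.conj (X j)).toMonoidHom.comp Φ = R := by
      apply PP_hom_ext
      intro i
      change X j * Φ _ * (X j)⁻¹ = sc (zh (ξ j) (hξ j).pow_eq_one _) * Φ _
      rw [hΦ]
      by_cases h : i = j
      · subst h
        rw [Pi.mulSingle_eq_same, zh_one, hXYi]
        simp only [mul_assoc, mul_inv_cancel, mul_one]
        rfl
      · rw [Pi.mulSingle_eq_of_ne (Ne.symm h), map_one, map_one, one_mul,
          (hXY j i (Ne.symm h)).eq, mul_assoc, mul_inv_cancel, mul_one]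
    have h2 : X j * Φ k * (X j)⁻¹ = sc (zh (ξ j) (hξ j).pow_eq_one (k j)) * Φ k :=
      DFunLike.congr_fun this k
    rw [← mul_assoc, ← h2]
    group
  let w : PP l → V := fun k => Φ k v
  have hXw : ∀ i k, X i (w k) = (lam i * (zh (ξ i) (hξ i).pow_eq_one (k i) : Fˣ) : F) • w k := by
    intro i k
    change (X i * Φ k) v = _
    rw [hconj]
    change ((zh (ξ i) (hξ i).pow_eq_one (k i) : Fˣ) : F) • Φ k (X i v) = _
    have := hv i
    simp only [LinearEquiv.coe_coe] at this
    rw [this, map_smul, smul_smul, mul_comm]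
  have hYw : ∀ i k, Y i (w k) = w (Pi.mulSingle i (Multiplicative.ofAdd 1) * k) := by
    intro i k
    change _ = Φ (_ * k) v
    rw [map_mul, hΦ]
    rfl
  have hw0 : ∀ k, w k ≠ 0 := fun k h => hv0 ((Φ k).map_eq_zero_iff.1 h)
  have hli : LinearIndependent F w := by
    have hind := Module.End.independent_iInf_maxGenEigenspace_of_forall_mapsTo
      (fun i => (X i).toLinearMap) (fun i j φ => Module.End.mapsTo_maxGenEigenspace_of_comm (by
        have := congrArg (fun g : V ≃ₗ[F] V => g.toLinearMap) (hXX j i)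
        exact this) φ)
    let χ : PP l → (Fin r → F) := fun k i => lam i * (zh (ξ i) (hξ i).pow_eq_one (k i) : Fˣ)
    have hχ : Function.Injective χ := by
      intro k m h
      funext i
      have h1 := congrFun h i
      have h2 := mul_left_cancel₀ (hlam0 i) h1
      exact zh_inj _ _ (hξ i) (Units.ext h2)
    refine (hind.comp hχ).linearIndependent _ (fun k => ?_) hw0
    change w k ∈ ⨅ i, _
    rw [Submodule.mem_iInf]
    intro i
    apply Module.End.mem_maxGenEigenspace _ _ _ |>.2
    refine ⟨1, ?_⟩
    have := hXw i k
    simp [this, χ]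
  have hspan : Submodule.span F (Set.range w) = ⊤ := by
    apply hirr
    · rw [Submodule.ne_bot_iff]
      exact ⟨w 1, Submodule.subset_span ⟨1, rfl⟩, hw0 1⟩
    · intro i
      have : Submodule.span F (Set.range w) ≤
          (Submodule.span F (Set.range w)).comap (X i).toLinearMap := by
        rw [Submodule.span_le]
        rintro _ ⟨k, rfl⟩
        change X i (w k) ∈ Submodule.span F (Set.range w)
        rw [hXw]
        exact Submodule.smul_mem _ _ (Submodule.subset_span ⟨k, rfl⟩)
      exact this
    · intro i
      have : Submodule.span F (Set.range w) ≤
          (Submodule.span F (Set.range w)).comap (Y i).toLinearMap := by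
        rw [Submodule.span_le]
        rintro _ ⟨k, rfl⟩
        change Y i (w k) ∈ Submodule.span F (Set.range w)
        rw [hYw]
        exact Submodule.subset_span ⟨_, rfl⟩
      exact this
  refine ⟨Module.Basis.mk hli hspan.ge, fun i => Units.mk0 (lam i) (hlam0 i), ?_, ?_⟩
  · intro i k
    simpa using hXw i k
  · intro i k
    simpa using hYw i k

theorem stmt13 (F V : Type) [Field F] [IsAlgClosed F] [CharZero F]
    [AddCommGroup V] [Module F V] [FiniteDimensional F V]
    (N : ℕ) (hN : 2 ≤ N) (hdim : Module.finrank F V = N)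
    (Q : Subgroup (PGL F V)) (hfin : Finite Q)
    (hab : ∀ a b, a ∈ Q → b ∈ Q → a * b = b * a)
    (hcentral : ∀ z : Module.End F V,
      (∀ e : V ≃ₗ[F] V, (QuotientGroup.mk e : PGL F V) ∈ Q →
        z ∘ₗ (e : V ≃ₗ[F] V).toLinearMap = (e : V ≃ₗ[F] V).toLinearMap ∘ₗ z) →
      ∃ c : F, z = c • LinearMap.id) :
    ∃ (r : ℕ) (l : Fin r → ℕ), (∀ i, 2 ≤ l i) ∧ (∏ i, l i) = N ∧
      ∃ (e : V ≃ₗ[F] PiTensorProduct F fun i => Fin (l i) → F)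
        (x y : ∀ i, (Fin (l i) → F) ≃ₗ[F] (Fin (l i) → F)) (ξ : Fin r → F),
        (∀ i, IsPrimitiveRoot (ξ i) (l i)) ∧
        (∀ i, LinearMap.det (x i).toLinearMap = 1) ∧
        (∀ i, LinearMap.det (y i).toLinearMap = 1) ∧
        (∀ i, (x i).toLinearMap ∘ₗ (y i).toLinearMap =
          ξ i • ((y i).toLinearMap ∘ₗ (x i).toLinearMap)) ∧
        Q = Subgroup.closure
          ((Set.range fun i => (QuotientGroup.mk (inducedFactorAut F e x i) : PGL F V)) ∪
           (Set.range fun i => (QuotientGroup.mk (inducedFactorAut F e y i) : PGL F V))) ∧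
        Nonempty (Q ≃* ((i : Fin r) → Multiplicative (ZMod (l i) × ZMod (l i)))) := by
  have : Nontrivial V := Module.nontrivial_of_finrank_pos (R := F) (by omega)
  let instQ : CommGroup Q :=
    { Q.toGroup with mul_comm := fun a b => Subtype.ext (hab a b a.2 b.2) }
  let sc : Fˣ →* (V ≃ₗ[F] V) := DistribMulAction.toModuleAut F V
  have hsc : ∀ c v, sc c v = (c : F) • v := fun c v => rfl
  have hcen : ∀ c g, sc c * g = g * sc c := by
    intro c g
    ext v
    change (c : F) • g v = g ((c : F) • v)
    rw [map_smul]
  have hscinj : Function.Injective sc := by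
    intro c d h
    obtain ⟨v, hv⟩ := exists_ne (0 : V)
    have := DFunLike.congr_fun h v
    rw [hsc, hsc] at this
    exact Units.ext (smul_left_injective F hv this)
  let π : (V ≃ₗ[F] V) →* PGL F V := QuotientGroup.mk' (scalarSubgroup F V)
  have hπ : Function.Surjective π := QuotientGroup.mk'_surjective _
  have hker : ∀ g, π g = 1 ↔ ∃ c, g = sc c := by
    intro g
    change (QuotientGroup.mk g : PGL F V) = 1 ↔ _
    rw [QuotientGroup.eq_one_iff]
    constructor
    · rintro ⟨c, hc⟩
      have hc0 : c ≠ 0 := by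
        rintro rfl
        obtain ⟨v, hv⟩ := exists_ne (0 : V)
        have := hc v
        rw [zero_smul] at this
        exact hv (g.map_eq_zero_iff.1 this)
      exact ⟨Units.mk0 c hc0, LinearEquiv.ext hc⟩
    · rintro ⟨c, rfl⟩
      exact ⟨c, fun v => rfl⟩
  obtain ⟨β, hβ⟩ := exists_pairing (K := Q) sc hscinj hcen π hπ hker Q.subtype
  have hβ1 : ∀ (p q : Q) g h, π g = (p : PGL F V) → π h = (q : PGL F V) → (β p q = 1 ↔ Commute g h) := by
    intro p q g h hg hh
    have := hβ p q g h hg hh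
    constructor
    · intro h1
      rw [h1, map_one, one_mul] at this
      exact this
    · intro h1
      rw [h1.eq] at this
      exact hscinj ((right_eq_mul.1 this).trans (map_one sc).symm)
  have halt : ∀ a, β a a = 1 := by
    intro a
    obtain ⟨g, hg⟩ := hπ a
    exact (hβ1 a a g g hg hg).2 (Commute.refl g)
  have hnd : ∀ a, (∀ b, β a b = 1) → a = 1 := by
    intro a ha
    obtain ⟨g, hg⟩ := hπ a
    obtain ⟨c, hc⟩ := hcentral g.toLinearMap (by
      intro e he
      have := (hβ1 a ⟨_, he⟩ g e hg rfl).1 (ha _)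
      exact congrArg (fun g : V ≃ₗ[F] V => g.toLinearMap) this)
    apply Subtype.ext
    rw [← hg]
    change (QuotientGroup.mk g : PGL F V) = 1
    rw [QuotientGroup.eq_one_iff]
    exact ⟨c, fun v => DFunLike.congr_fun hc v⟩
  have hskew : ∀ a b, β b a = (β a b)⁻¹ := by
    intro a b
    have := halt (a * b)
    simp only [map_mul, MonoidHom.mul_apply, halt, one_mul, mul_one] at this
    exact eq_inv_of_mul_eq_one_left (by rw [mul_comm]; simpa [mul_comm] using this)
  obtain ⟨r, l, a, b, hl, hp, haa, hbb, hab', hcl⟩ := symplectic_basis _ Q β halt hnd rfl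
  have hl0 : ∀ i, l i ≠ 0 := fun i => by have := hl i; omega
  -- an element pairing trivially with the generators is trivial
  have hgen : ∀ q, (∀ i, β q (a i) = 1) → (∀ i, β q (b i) = 1) → q = 1 := by
    intro q h1 h2
    apply hnd
    have : (β q).ker = ⊤ := by
      rw [eq_top_iff, ← hcl, Subgroup.closure_le]
      rintro x (⟨i, rfl⟩ | ⟨i, rfl⟩)
      · exact h1 i
      · exact h2 i
    intro c
    have hc : c ∈ (β q).ker := this ▸ Subgroup.mem_top c
    exact hc
  have hla : ∀ i, a i ^ l i = 1 := by
    intro i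
    apply hgen
    · intro j
      rw [map_pow, MonoidHom.pow_apply, haa, one_pow]
    · intro j
      rw [map_pow, MonoidHom.pow_apply]
      by_cases h : i = j
      · subst h; exact (hp i).pow_eq_one
      · rw [hab' i j h, one_pow]
  have hlb : ∀ i, b i ^ l i = 1 := by
    intro i
    apply hgen
    · intro j
      rw [map_pow, MonoidHom.pow_apply, hskew (a j)]
      by_cases h : j = i
      · subst h; rw [inv_pow, (hp j).pow_eq_one, inv_one]
      · rw [hab' j i h, inv_one, one_pow]
    · intro j
      rw [map_pow, MonoidHom.pow_apply, hbb, one_pow]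
  -- normalised lifts
  have hlift : ∀ (q : Q) (n : ℕ), n ≠ 0 → q ^ n = 1 → ∃ g, π g = (q : PGL F V) ∧ g ^ n = 1 := by
    intro q n hn hq
    obtain ⟨g, hg⟩ := hπ q
    obtain ⟨c, hc⟩ := (hker (g ^ n)).1 (by
      rw [map_pow, hg]
      exact congrArg Subtype.val hq)
    obtain ⟨d, hd⟩ := exists_unit_pow n hn c⁻¹
    refine ⟨sc d * g, ?_, ?_⟩
    · rw [map_mul, (hker (sc d)).2 ⟨d, rfl⟩, one_mul, hg]
    · rw [(show Commute (sc d) g from hcen d g).mul_pow, hc, ← map_pow, hd, ← map_mul,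
        inv_mul_cancel, map_one]
  choose X hXa hXl using fun i => hlift (a i) (l i) (hl0 i) (hla i)
  choose Y hYb hYl using fun i => hlift (b i) (l i) (hl0 i) (hlb i)
  have hQcl : Q = Subgroup.closure ((Set.range fun i => π (X i)) ∪ (Set.range fun i => π (Y i))) := by
    have := congrArg (Subgroup.map Q.subtype) hcl
    rw [MonoidHom.map_closure, Set.image_union, ← Set.range_comp, ← Set.range_comp] at this
    have h2 : Subgroup.map Q.subtype (⊤ : Subgroup Q) = Q := by
      rw [← MonoidHom.range_eq_map, Subgroup.range_subtype]
    rw [h2] at this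
    rw [← this]
    simp only [hXa, hYb]
    rfl
  have hirr : ∀ W : Submodule F V, W ≠ ⊥ → (∀ i, ∀ w ∈ W, X i w ∈ W) →
      (∀ i, ∀ w ∈ W, Y i w ∈ W) → W = ⊤ := by
    intro W hW hWX hWY
    apply maschke_part F V Q hfin hcentral W hW
    let S : Subgroup (V ≃ₗ[F] V) :=
      { carrier := {g | ∀ w, g w ∈ W ↔ w ∈ W}
        one_mem' := fun w => Iff.rfl
        mul_mem' := fun {g h} hg hh w => (hg (h w)).trans (hh w)
        inv_mem' := fun {g} hg w => by
          rw [← hg]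
          change g (g.symm w) ∈ W ↔ _
          rw [g.apply_symm_apply] }
    have hpowS : ∀ (g : V ≃ₗ[F] V) (n : ℕ), n ≠ 0 → g ^ n = 1 → (∀ w ∈ W, g w ∈ W) → g ∈ S := by
      intro g n hn hgn hg w
      refine ⟨fun h => ?_, hg w⟩
      have hk : ∀ (k : ℕ) (u : V), u ∈ W → (g ^ k) u ∈ W := by
        intro k
        induction k with
        | zero => intro u hu; exact hu
        | succ k ihk => intro u hu; rw [pow_succ]; exact ihk _ (hg u hu)
      have h1 := hk (n - 1) _ h
      have h2 : (g ^ (n - 1)) (g w) = w := by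
        change (g ^ (n - 1) * g) w = w
        rw [← pow_succ, Nat.sub_add_cancel (Nat.pos_of_ne_zero hn), hgn]
        rfl
      rwa [h2] at h1
    have hQS : Q ≤ S.map π := by
      rw [hQcl, Subgroup.closure_le]
      rintro x (⟨i, rfl⟩ | ⟨i, rfl⟩)
      · exact ⟨X i, hpowS _ _ (hl0 i) (hXl i) (hWX i), rfl⟩
      · exact ⟨Y i, hpowS _ _ (hl0 i) (hYl i) (hWY i), rfl⟩
    intro g hg w hw
    obtain ⟨s, hs, hsg⟩ := hQS hg
    have hsg' : π s = π g := hsg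
    obtain ⟨c, hc⟩ := (hker (g * s⁻¹)).1 (by rw [map_mul, map_inv, hsg', mul_inv_cancel])
    have hgs : g = sc c * s := by rw [← hc]; group
    rw [hgs]
    change (c : F) • s w ∈ W
    exact W.smul_mem _ ((hs w).2 hw)
  obtain ⟨bV, lam, hbX, hbY⟩ := basis_part F V l hl X Y (fun i => β (a i) (b i)) hp hXl hYl
    (fun i j => (hβ1 _ _ _ _ (hXa i) (hXa j)).1 (haa i j))
    (fun i j => (hβ1 _ _ _ _ (hYb i) (hYb j)).1 (hbb i j))
    (fun i j h => (hβ1 _ _ _ _ (hXa i) (hYb j)).1 (hab' i j h))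
    (fun i => hβ _ _ _ _ (hXa i) (hYb i)) hirr
  obtain ⟨e, x, y, hdx, hdy, hxy, hmx, hmy⟩ := tensor_part F V l hl bV X Y
    (fun i t => lam i * zh _ (hp i).pow_eq_one t) (fun i => (β (a i) (b i) : F))
    (fun i t => by
      rw [map_mul, zh_one]
      push_cast
      ring) hbX hbY
  refine ⟨r, l, hl, ?_, e, x, y, fun i => (β (a i) (b i) : F), ?_, hdx, hdy, hxy, ?_, ?_⟩
  · have : ∀ i, NeZero (l i) := fun i => ⟨hl0 i⟩
    rw [← hdim, Module.finrank_eq_nat_card_basis bV, Nat.card_pi]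
    refine Finset.prod_congr rfl fun i _ => ?_
    exact (Nat.card_zmod (l i)).symm
  · intro i
    exact IsPrimitiveRoot.coe_units_iff.2 (hp i)
  · simp only [hmx, hmy]
    exact hQcl
  · exact symplectic_iso Q β hskew r l a b hla hlb hp haa hbb hab' hcl
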